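/- Let H be a complex Hilbert space, A a unital C*-algebra, π : A →⋆ₐ[ℂ] (H →L[ℂ] H) a unital star-algebra homomorphism, and Ω ∈ H a cyclic vector, i.e. the closure of the linear span of {π(a) Ω : a ∈ A} is all of H. Let α : A ≃⋆ₐ[ℂ] A be a star-algebra automorphism such that the vector state is α-invariant: ⟪Ω, π(α(a)) Ω⟫ = ⟪Ω, π(a) Ω⟫ for all a ∈ A. Then there exists a unique unitary operator U : H →L[ℂ] H such that U (π(a) Ω) = π(α(a)) Ω for all a ∈ A; moreover U Ω = Ω. (This is the construction of the space-time translation unitaries U(x,t) on the GNS representation of a stationary, translationally invariant state.) -/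

import Mathlib

open scoped InnerProductSpace

theorem gns_implementing_unitary
    (H : Type*) [NormedAddCommGroup H] [InnerProductSpace ℂ H] [CompleteSpace H]
    (A : Type*) [NormedRing A] [StarRing A] [CStarRing A]
    [NormedAlgebra ℂ A] [StarModule ℂ A]
    (π : A →⋆ₐ[ℂ] (H →L[ℂ] H)) (Ω : H)
    (hcyc : (Submodule.span ℂ (Set.range fun a : A => π a Ω)).topologicalClosure = ⊤)
    (α : A ≃⋆ₐ[ℂ] A)
    (hinv : ∀ a : A, ⟪Ω, π (α a) Ω⟫_ℂ = ⟪Ω, π a Ω⟫_ℂ) :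
    (∃! U : H →L[ℂ] H,
        U ∈ unitary (H →L[ℂ] H) ∧ ∀ a : A, U (π a Ω) = π (α a) Ω) ∧
      ∀ U : H →L[ℂ] H,
        (U ∈ unitary (H →L[ℂ] H) ∧ ∀ a : A, U (π a Ω) = π (α a) Ω) → U Ω = Ω := by
  have hip : ∀ a b : A, ⟪π a Ω, π b Ω⟫_ℂ = ⟪Ω, π (star a * b) Ω⟫_ℂ := by
    intro a b
    rw [map_mul, map_star, ContinuousLinearMap.star_eq_adjoint, ContinuousLinearMap.mul_apply,
      ContinuousLinearMap.adjoint_inner_right]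
  have hnorm : ∀ a : A, ‖π (α a) Ω‖ = ‖π a Ω‖ := by
    intro a
    have h : ⟪π (α a) Ω, π (α a) Ω⟫_ℂ = ⟪π a Ω, π a Ω⟫_ℂ := by
      rw [hip, hip, ← map_star, ← map_mul, hinv]
    rw [@norm_eq_sqrt_re_inner ℂ, @norm_eq_sqrt_re_inner ℂ _ _ _ _ (π a Ω), h]
  let e : A →ₗ[ℂ] H :=
    { toFun := fun a => π a Ω
      map_add' := fun a b => by simp
      map_smul' := fun c a => by simp }
  have hd : DenseRange e := by
    have h1 : Submodule.span ℂ (Set.range fun a : A => π a Ω) = LinearMap.range e := by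
      rw [← Submodule.span_eq (LinearMap.range e)]
      rfl
    rw [h1, ← Submodule.dense_iff_topologicalClosure_eq_top] at hcyc
    exact hcyc
  let f : A ≃ₗ[ℂ] A :=
    { toFun := α
      invFun := α.symm
      map_add' := fun a b => map_add α a b
      map_smul' := fun c a => map_smul α c a
      left_inv := fun a => α.symm_apply_apply a
      right_inv := fun a => α.apply_symm_apply a }
  have hn : ∀ x, ‖e (f x)‖ = ‖e x‖ := hnorm
  let V : H ≃ₗᵢ[ℂ] H := f.extendOfIsometry e e hd hd hn
  have hV : ∀ a : A, V (π a Ω) = π (α a) Ω := fun a =>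
    LinearEquiv.extendOfIsometry_eq f e e hd hd hn a
  refine ⟨⟨(Unitary.linearIsometryEquiv.symm V : unitary (H →L[ℂ] H)), ⟨SetLike.coe_mem _, hV⟩, ?_⟩, ?_⟩
  · rintro W ⟨-, hW⟩
    apply DFunLike.coe_injective
    refine hd.equalizer W.continuous (ContinuousLinearMap.continuous _) ?_
    funext a
    exact (hW a).trans (hV a).symm
  · rintro U ⟨-, hU⟩
    simpa using hU 1
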